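/- Let 0 < α < 1/2, f : [0,1] → ℝ be α-Hölder, and Φ : [0,1] → ℝ^d be α-bi-Hölder. Then for Lebesgue-almost every t ∈ ℝ^d, the pushforward measure (f_t)_* L¹|[0,1], where f_t(x) = f(x) + ⟨t, Φ(x)⟩, is absolutely continuous with respect to Lebesgue measure with a bounded continuous density. -/

import Mathlib

open MeasureTheory Set

open scoped ContDiff FourierTransform in
theorem real_measure_ext_of_integral_contDiff {μ ν : Measure ℝ} [IsLocallyFiniteMeasure μ]
    [IsLocallyFiniteMeasure ν]
    (h : ∀ g : ℝ → ℝ, ContDiff ℝ ∞ g → HasCompactSupport g → ∫ x, g x ∂μ = ∫ x, g x ∂ν) :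
    μ = ν := by
  refine Real.measure_ext_Ioo_rat fun p q => ?_
  rcases le_or_gt (q : ℝ) p with hpq | hpq
  · simp [Ioo_eq_empty_of_le hpq]
  set c : ℝ := (p + q) / 2 with hc
  set R : ℝ := (q - p) / 2 with hR
  have hR0 : 0 < R := by rw [hR]; linarith
  have hball : Ioo (p : ℝ) q = Metric.ball c R := by
    rw [Real.ball_eq_Ioo]; congr 1 <;> rw [hc, hR] <;> ring
  let k : ℕ → ContDiffBump c := fun n =>
    { rIn := R * (1 - 1 / ((n : ℝ) + 2))
      rOut := R
      rIn_pos := by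
        have : 1 / ((n : ℝ) + 2) < 1 := by
          rw [div_lt_one (by positivity)]; linarith [Nat.cast_nonneg (α := ℝ) n]
        exact mul_pos hR0 (by linarith)
      rIn_lt_rOut := by
        have : 0 < 1 / ((n : ℝ) + 2) := by positivity
        nlinarith }
  have key : ∀ (m : Measure ℝ) [IsLocallyFiniteMeasure m],
      Filter.Tendsto (fun n => ∫ x, k n x ∂m) Filter.atTop (nhds (m.real (Metric.ball c R))) := by
    intro m _
    rw [← integral_indicator_one Metric.isOpen_ball.measurableSet]
    refine tendsto_integral_of_dominated_convergence ((Metric.ball c R).indicator 1)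
      (fun n => (k n).continuous.aestronglyMeasurable) ?_ ?_ ?_
    · exact (integrable_indicator_iff Metric.isOpen_ball.measurableSet).2
        (integrableOn_const (by exact measure_ball_lt_top.ne))
    · intro n
      refine Filter.Eventually.of_forall fun x => ?_
      by_cases hx : x ∈ Metric.ball c R
      · simpa [indicator_of_mem hx, abs_of_nonneg (k n).nonneg] using (k n).le_one
      · have : k n x = 0 := by
          have := (k n).support_eq
          by_contra hne
          exact hx (this ▸ hne)
        simp [this, indicator_of_notMem hx]
    · refine Filter.Eventually.of_forall fun x => ?_
      by_cases hx : x ∈ Metric.ball c R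
      · rw [indicator_of_mem hx]
        refine tendsto_const_nhds.congr' ?_
        have hlim : Filter.Tendsto (fun n : ℕ => R * (1 - 1 / ((n : ℝ) + 2))) Filter.atTop
            (nhds (R * (1 - 0))) := by
          refine Filter.Tendsto.const_mul _ (tendsto_const_nhds.sub ?_)
          exact tendsto_const_nhds.div_atTop
            (Filter.tendsto_atTop_add_const_right _ _ tendsto_natCast_atTop_atTop)
        have hx' : dist x c < R * (1 - 0) := by simpa using hx
        filter_upwards [hlim.eventually (lt_mem_nhds hx')] with n hn
        exact ((k n).one_of_mem_closedBall (Metric.mem_closedBall.2 hn.le)).symm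
      · rw [indicator_of_notMem hx]
        refine tendsto_const_nhds.congr fun n => ?_
        by_contra hne
        exact hx ((k n).support_eq ▸ (Ne.symm hne : k n x ≠ 0))
  have h1 := key μ
  have h2 := key ν
  simp_rw [fun n => h (k n) (k n).contDiff (k n).hasCompactSupport] at h1
  have h3 := tendsto_nhds_unique h1 h2
  rw [hball]
  exact (ENNReal.toReal_eq_toReal_iff' measure_ball_lt_top.ne measure_ball_lt_top.ne).1 h3

open scoped ContDiff FourierTransform in
theorem integral_eq_integral_fourierInv_mul {μ : Measure ℝ} [IsFiniteMeasure μ]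
    (hμ : Integrable (VectorFourier.fourierIntegral Real.fourierChar μ (innerₗ ℝ) (1 : ℝ → ℂ)))
    (k : SchwartzMap ℝ ℂ) :
    ∫ x, k x ∂μ =
      ∫ x, 𝓕⁻ (VectorFourier.fourierIntegral Real.fourierChar μ (innerₗ ℝ) (1 : ℝ → ℂ)) x * k x := by
  have h1 := VectorFourier.integral_fourierIntegral_smul_eq_flip (μ := μ) (ν := volume)
    (L := innerₗ ℝ) (f := (1 : ℝ → ℂ)) (g := (𝓕⁻ k : SchwartzMap ℝ ℂ))
    Real.continuous_fourierChar (by exact continuous_inner)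
    (integrable_const (1 : ℂ)) (𝓕⁻ k : SchwartzMap ℝ ℂ).integrable
  have h2 := VectorFourier.integral_fourierIntegral_smul_eq_flip (μ := (volume : Measure ℝ))
    (ν := volume) (L := -innerₗ ℝ)
    (f := VectorFourier.fourierIntegral Real.fourierChar μ (innerₗ ℝ) (1 : ℝ → ℂ)) (g := k)
    Real.continuous_fourierChar (by exact continuous_inner.neg) hμ k.integrable
  have e1 : VectorFourier.fourierIntegral Real.fourierChar volume (innerₗ ℝ).flip
      (𝓕⁻ k : SchwartzMap ℝ ℂ) = k := by
    have : (innerₗ ℝ).flip = innerₗ ℝ := flip_innerₗ ℝ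
    rw [this]
    change (𝓕 ((𝓕⁻ k : SchwartzMap ℝ ℂ) : ℝ → ℂ)) = k
    rw [← SchwartzMap.fourier_coe, FourierTransform.fourier_fourierInv_eq]
  have e2 : VectorFourier.fourierIntegral Real.fourierChar volume (-innerₗ ℝ).flip k
      = (𝓕⁻ k : SchwartzMap ℝ ℂ) := by
    have : (-innerₗ ℝ).flip = -innerₗ ℝ := by
      ext; simp
    rw [this, SchwartzMap.fourierInv_coe]
    rfl
  rw [e1] at h1
  rw [e2] at h2
  simp only [Pi.one_apply, smul_eq_mul, one_mul] at h1 h2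
  rw [← h1, ← h2]
  rfl

open scoped ContDiff FourierTransform in
/-- A finite measure on `ℝ` with integrable characteristic function has a bounded continuous
density. -/
theorem exists_continuous_density_of_integrable_charFun {μ : Measure ℝ} [IsFiniteMeasure μ]
    (hμ : Integrable (charFun μ)) :
    ∃ h : ℝ → ℝ, Continuous h ∧ (∃ M : ℝ, ∀ y, h y ≤ M) ∧ (∀ y, 0 ≤ h y) ∧
      ∀ A : Set ℝ, MeasurableSet A → μ A = ENNReal.ofReal (∫ y in A, h y) := by
  set F := VectorFourier.fourierIntegral Real.fourierChar μ (innerₗ ℝ) (1 : ℝ → ℂ) with hF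
  have hFi : Integrable F := by
    have : F = fun ξ => charFun μ (-(2 * Real.pi) * ξ) := by
      ext ξ
      rw [charFun_eq_fourierIntegral', hF]
      congr 1
      simp only [smul_eq_mul]
      field_simp
    rw [this]
    exact hμ.comp_mul_left' (by simp [Real.pi_ne_zero])
  have hcont : Continuous (𝓕⁻ F) := by
    exact VectorFourier.fourierIntegral_continuous (L := -innerₗ ℝ) Real.continuous_fourierChar
      (by exact continuous_inner.neg) hFi
  set h : ℝ → ℝ := fun x => (𝓕⁻ F x).re with hh
  have hc : Continuous h := Complex.continuous_re.comp hcont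
  have htest : ∀ g : ℝ → ℝ, ContDiff ℝ ∞ g → HasCompactSupport g →
      ∫ x, g x ∂μ = ∫ x, h x * g x := by
    intro g hg hgs
    have hgs' : HasCompactSupport (fun x => (g x : ℂ)) :=
      hgs.comp_left (g := fun x : ℝ => (x : ℂ)) Complex.ofReal_zero
    have hg' : ContDiff ℝ ∞ (fun x => (g x : ℂ)) := Complex.ofRealCLM.contDiff.comp hg
    have := integral_eq_integral_fourierInv_mul hFi (hgs'.toSchwartzMap hg')
    simp only [HasCompactSupport.toSchwartzMap_toFun] at this
    have hint : Integrable (fun x => 𝓕⁻ F x * (g x : ℂ)) :=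
      (hcont.mul hg'.continuous).integrable_of_hasCompactSupport hgs'.mul_left
    have h2 := congrArg Complex.re this
    rw [integral_complex_ofReal, Complex.ofReal_re] at h2
    rw [h2]
    exact (integral_re hint).symm.trans (by simp [hh])
  have hnn : ∀ y, 0 ≤ h y := by
    intro y
    by_contra! hy
    obtain ⟨g, hgsub, hgs, hg, hgr, hgy⟩ := exists_contDiff_tsupport_subset (n := ⊤)
      ((isOpen_lt hc continuous_const).mem_nhds hy)
    have hg0 : ∀ x, 0 ≤ g x := fun x => (hgr (mem_range_self x)).1
    have h1 : 0 < ∫ x, -(h x * g x) := by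
      refine Continuous.integral_pos_of_hasCompactSupport_nonneg_nonzero (x := y)
        (hc.mul hg.continuous).neg hgs.mul_left.neg ?_ (by simp [hgy, hy.ne])
      intro x
      by_cases hx : x ∈ tsupport g
      · have : h x < 0 := hgsub hx
        have := hg0 x
        simp only [Pi.zero_apply]
        nlinarith
      · simp [image_eq_zero_of_notMem_tsupport hx]
    rw [integral_neg, ← htest g hg hgs] at h1
    have := integral_nonneg (μ := μ) (f := g) hg0
    linarith
  have hM : ∀ y, h y ≤ ∫ v, ‖F v‖ := fun y =>
    (Complex.re_le_norm _).trans
      (VectorFourier.norm_fourierIntegral_le_integral_norm _ _ (-innerₗ ℝ) _ _)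
  have hμh : μ = volume.withDensity (fun x => ENNReal.ofReal (h x)) := by
    have := IsLocallyFiniteMeasure.withDensity_ofReal (μ := (volume : Measure ℝ)) hc
    refine real_measure_ext_of_integral_contDiff fun g hg hgs => ?_
    rw [htest g hg hgs, integral_withDensity_eq_integral_toReal_smul
      (by fun_prop) (by simp)]
    simp [hnn]
  refine ⟨h, hc, ⟨_, hM⟩, hnn, fun A hA => ?_⟩
  have hfin : ∫⁻ x, ENNReal.ofReal (h x) < ⊤ := by
    have := measure_lt_top μ univ
    rwa [hμh, withDensity_apply _ MeasurableSet.univ, Measure.restrict_univ] at this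
  have hhi : Integrable h := by
    refine ⟨hc.aestronglyMeasurable, ?_⟩
    rw [hasFiniteIntegral_iff_ofReal (Filter.Eventually.of_forall hnn)]
    exact hfin
  rw [hμh, withDensity_apply _ hA, ofReal_integral_eq_lintegral_ofReal hhi.integrableOn
    (Filter.Eventually.of_forall hnn)]

open scoped ComplexConjugate in
theorem integral_norm_sq_integral_le {T X : Type*} [MeasurableSpace T] [MeasurableSpace X]
    (P : Measure T) [IsFiniteMeasure P] (m : Measure X) [IsFiniteMeasure m] {e : T → X → ℂ}
    (he : StronglyMeasurable (Function.uncurry e)) (hb : ∀ t x, ‖e t x‖ ≤ 1) :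
    ∫ t, ‖∫ x, e t x ∂m‖ ^ 2 ∂P ≤
      ∫ z, ‖∫ t, e t z.1 * conj (e t z.2) ∂P‖ ∂(m.prod m) := by
  have hsq : ∀ t, ((‖∫ x, e t x ∂m‖ ^ 2 : ℝ) : ℂ) =
      ∫ z : X × X, e t z.1 * conj (e t z.2) ∂(m.prod m) := by
    intro t
    rw [integral_prod_mul (fun x => e t x) (fun y => conj (e t y)), integral_conj,
      Complex.mul_conj']
    push_cast
    rfl
  have hmeas : StronglyMeasurable
      (Function.uncurry fun (t : T) (z : X × X) => e t z.1 * conj (e t z.2)) := by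
    refine StronglyMeasurable.mul ?_ (Complex.continuous_conj.comp_stronglyMeasurable ?_)
    · exact he.comp_measurable
        (measurable_fst.prodMk (measurable_fst.comp measurable_snd))
    · exact he.comp_measurable
        (measurable_fst.prodMk (measurable_snd.comp measurable_snd))
  have hint : Integrable
      (Function.uncurry fun (t : T) (z : X × X) => e t z.1 * conj (e t z.2))
      (P.prod (m.prod m)) := by
    refine Integrable.of_bound hmeas.aestronglyMeasurable 1 (Filter.Eventually.of_forall ?_)
    rintro ⟨t, z⟩
    simp only [Function.uncurry_apply_pair, norm_mul, RCLike.norm_conj]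
    exact mul_le_one₀ (hb _ _) (norm_nonneg _) (hb _ _)
  have hC : ((∫ t, ‖∫ x, e t x ∂m‖ ^ 2 ∂P : ℝ) : ℂ) =
      ∫ z, ∫ t, e t z.1 * conj (e t z.2) ∂P ∂(m.prod m) := by
    rw [← integral_complex_ofReal]
    simp_rw [hsq]
    exact integral_integral_swap hint
  calc ∫ t, ‖∫ x, e t x ∂m‖ ^ 2 ∂P ≤ ‖((∫ t, ‖∫ x, e t x ∂m‖ ^ 2 ∂P : ℝ) : ℂ)‖ := by
        rw [Complex.norm_real]; exact le_abs_self _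
    _ ≤ _ := by rw [hC]; exact norm_integral_le_integral_norm _

theorem integrable_exp_neg_sum_sq (d : ℕ) :
    Integrable (fun t : Fin d → ℝ => Real.exp (-∑ i, t i ^ 2)) := by
  have := GaussianFourier.integrable_cexp_neg_sum_mul_add (ι := Fin d) (b := fun _ => 1)
    (by simp) (fun _ => 0)
  refine this.norm.congr (Filter.Eventually.of_forall fun t => ?_)
  simp [Complex.norm_exp, ← Complex.ofReal_pow]

/-- The unnormalised Gaussian measure on `ℝ^d` with density `exp (-∑ i, t i ^ 2)`. -/
noncomputable def expNegSumSqMeasure (d : ℕ) : Measure (Fin d → ℝ) :=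
  volume.withDensity fun t => ENNReal.ofReal (Real.exp (-∑ i, t i ^ 2))

instance (d : ℕ) : IsFiniteMeasure (expNegSumSqMeasure d) :=
  isFiniteMeasure_withDensity_ofReal (integrable_exp_neg_sum_sq d).2

theorem volume_absolutelyContinuous_expNegSumSqMeasure (d : ℕ) :
    (volume : Measure (Fin d → ℝ)) ≪ expNegSumSqMeasure d :=
  withDensity_absolutelyContinuous'
    (Measurable.ennreal_ofReal (by fun_prop)).aemeasurable
    (Filter.Eventually.of_forall fun t => by simp [Real.exp_pos])

theorem norm_integral_cexp_expNegSumSqMeasure (d : ℕ) (v : Fin d → ℝ) :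
    ‖∫ t, Complex.exp ((∑ i, t i * v i : ℝ) * Complex.I) ∂(expNegSumSqMeasure d)‖ =
      √Real.pi ^ d * Real.exp (-(∑ i, v i ^ 2) / 4) := by
  rw [expNegSumSqMeasure, integral_withDensity_eq_integral_toReal_smul
    (Measurable.ennreal_ofReal (by fun_prop)) (by simp)]
  have := GaussianFourier.integral_cexp_neg_sum_mul_add (ι := Fin d) (b := fun _ => 1)
    (by simp) (fun i => v i * Complex.I)
  have h2 : ∀ t : Fin d → ℝ, (ENNReal.ofReal (Real.exp (-∑ i, t i ^ 2))).toReal •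
      Complex.exp ((∑ i, t i * v i : ℝ) * Complex.I) =
      Complex.exp (-∑ i, 1 * (t i : ℂ) ^ 2 + ∑ i, v i * Complex.I * t i) := by
    intro t
    rw [ENNReal.toReal_ofReal (Real.exp_pos _).le, Complex.real_smul, Complex.ofReal_exp,
      ← Complex.exp_add]
    push_cast
    rw [Finset.sum_mul]
    congr 2
    · simp
    · exact Finset.sum_congr rfl fun i _ => by ring
  simp_rw [h2]
  rw [this, Finset.prod_mul_distrib, Finset.prod_const, ← Complex.exp_sum, norm_mul, norm_pow,
    Complex.norm_exp, Finset.card_univ, Fintype.card_fin]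
  congr 2
  · rw [div_one, Complex.norm_cpow_eq_rpow_re_of_pos Real.pi_pos, Real.sqrt_eq_rpow]
    simp
  · simp only [mul_pow, Complex.I_sq, mul_neg, mul_one, Complex.re_sum]
    have hre : ∀ i, (-(v i : ℂ) ^ 2 / 4).re = -v i ^ 2 / 4 := fun i => by
      rw [show (-(v i : ℂ) ^ 2 / 4) = ((-v i ^ 2 / 4 : ℝ) : ℂ) by push_cast; ring,
        Complex.ofReal_re]
    simp_rw [hre, ← Finset.sum_div, Finset.sum_neg_distrib]

theorem integrable_abs_sub_rpow {β : ℝ} (hβ : β < 1) :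
    Integrable (fun z : ℝ × ℝ => |z.1 - z.2| ^ (-β))
      ((volume.restrict (Icc (0 : ℝ) 1)).prod (volume.restrict (Icc (0 : ℝ) 1))) := by
  have h1 : LocallyIntegrable (fun u : ℝ => |u| ^ (-β)) :=
    locallyIntegrable_of_norm_le_rpow (C := 1) (α := β) (by simp) (by simpa using hβ)
      (Filter.Eventually.of_forall fun u => by
        rw [Real.norm_of_nonneg (by positivity), one_mul, Real.norm_eq_abs])
      (measurable_norm.pow_const (-β)).aestronglyMeasurable
  have h2 : Integrable ((Icc (-1 : ℝ) 1).indicator fun u : ℝ => |u| ^ (-β)) :=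
    (integrable_indicator_iff measurableSet_Icc).2 (h1.integrableOn_isCompact isCompact_Icc)
  have h3 : Integrable ((Icc (0 : ℝ) 1).indicator fun _ : ℝ => (1 : ℝ)) :=
    (integrable_indicator_iff measurableSet_Icc).2
      (integrableOn_const (by simp))
  have h4 := h3.convolution_integrand (ContinuousLinearMap.mul ℝ ℝ) h2
  rw [Measure.prod_restrict]
  refine h4.integrableOn.congr_fun ?_ (measurableSet_Icc.prod measurableSet_Icc)
  rintro ⟨x, y⟩ ⟨hx, hy⟩
  simp only [mem_Icc] at hx hy
  have hxy : x - y ∈ Icc (-1 : ℝ) 1 := ⟨by linarith, by linarith⟩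
  simp [indicator_of_mem hxy, indicator_of_mem (show y ∈ Icc (0 : ℝ) 1 from hy)]

theorem exp_neg_sq_mul_le {ξ u U p : ℝ} (hu : 0 < u) (huU : u ≤ U) (hp : 0 < p) :
    Real.exp (-(ξ ^ 2 * u)) ≤ Real.exp U * p ^ p * (1 + ξ ^ 2) ^ (-p) * u ^ (-p) := by
  have hξ : 0 < 1 + ξ ^ 2 := by positivity
  set s := (1 + ξ ^ 2) * u with hs
  have hs0 : 0 < s := by positivity
  have h1 : s / p ≤ Real.exp (s / p) := by linarith [Real.add_one_le_exp (s / p)]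
  have h2 : (s / p) ^ p ≤ Real.exp s := by
    calc (s / p) ^ p ≤ Real.exp (s / p) ^ p := Real.rpow_le_rpow (by positivity) h1 hp.le
      _ = Real.exp s := by rw [← Real.exp_mul, div_mul_cancel₀ _ hp.ne']
  rw [Real.div_rpow hs0.le hp.le, div_le_iff₀ (by positivity)] at h2
  have h3 : Real.exp (-s) ≤ p ^ p * s ^ (-p) := by
    rw [Real.exp_neg, Real.rpow_neg hs0.le, ← div_eq_mul_inv, le_div_iff₀ (by positivity),
      inv_mul_le_iff₀ (Real.exp_pos _)]
    exact h2
  calc Real.exp (-(ξ ^ 2 * u)) = Real.exp u * Real.exp (-s) := by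
        rw [← Real.exp_add, hs]; congr 1; ring
    _ ≤ Real.exp U * (p ^ p * s ^ (-p)) := by gcongr
    _ = _ := by rw [hs, Real.mul_rpow hξ.le hu.le]; ring

theorem ae_fst_ne_snd (m : Measure ℝ) [SFinite m] [NullSingletonClass m] :
    ∀ᵐ z : ℝ × ℝ ∂(m.prod m), z.1 ≠ z.2 := by
  refine (Measure.ae_prod_iff_ae_ae
    (measurableSet_eq_fun measurable_fst measurable_snd).compl).2 ?_
  refine Filter.Eventually.of_forall fun x => ?_
  filter_upwards [Measure.ae_ne m x] with y hy using hy.symm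

section OccupationMeasure

variable {d : ℕ} {f : ℝ → ℝ} {Φ : ℝ → Fin d → ℝ} {α c p : ℝ}

open scoped ComplexConjugate in
theorem norm_integral_phase_mul_conj (ξ : ℝ) (x y : ℝ) :
    ‖∫ t, Complex.exp ((ξ * (f x + ∑ i, t i * Φ x i) : ℝ) * Complex.I) *
        conj (Complex.exp ((ξ * (f y + ∑ i, t i * Φ y i) : ℝ) * Complex.I))
        ∂(expNegSumSqMeasure d)‖ =
      √Real.pi ^ d * Real.exp (-(ξ ^ 2 * ((∑ i, (Φ x i - Φ y i) ^ 2) / 4))) := by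
  have h : ∀ t : Fin d → ℝ,
      Complex.exp ((ξ * (f x + ∑ i, t i * Φ x i) : ℝ) * Complex.I) *
        conj (Complex.exp ((ξ * (f y + ∑ i, t i * Φ y i) : ℝ) * Complex.I)) =
      Complex.exp ((ξ * (f x - f y) : ℝ) * Complex.I) *
        Complex.exp ((∑ i, t i * (ξ * (Φ x i - Φ y i)) : ℝ) * Complex.I) := by
    intro t
    rw [← Complex.exp_conj, ← Complex.exp_add, ← Complex.exp_add]
    congr 1
    have hsum : ∑ i, t i * (ξ * (Φ x i - Φ y i)) =
        ξ * (∑ i, t i * Φ x i) - ξ * ∑ i, t i * Φ y i := by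
      rw [Finset.mul_sum, Finset.mul_sum, ← Finset.sum_sub_distrib]
      exact Finset.sum_congr rfl fun i _ => by ring
    rw [hsum, map_mul, Complex.conj_ofReal, Complex.conj_I]
    push_cast
    ring
  simp_rw [h]
  rw [integral_const_mul, norm_mul, Complex.norm_exp_ofReal_mul_I, one_mul,
    norm_integral_cexp_expNegSumSqMeasure d (fun i => ξ * (Φ x i - Φ y i))]
  simp_rw [mul_pow, ← Finset.mul_sum]
  congr 2
  ring

theorem sq_norm_le_sum_sq (v : Fin d → ℝ) : ‖v‖ ^ 2 ≤ ∑ i, v i ^ 2 := by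
  have h : ‖v‖ ≤ √(∑ i, v i ^ 2) := by
    refine (pi_norm_le_iff_of_nonneg (Real.sqrt_nonneg _)).2 fun i => ?_
    refine Real.le_sqrt_of_sq_le ?_
    rw [Real.norm_eq_abs, sq_abs]
    exact Finset.single_le_sum (f := fun i => v i ^ 2) (fun i _ => sq_nonneg _)
      (Finset.mem_univ i)
  calc ‖v‖ ^ 2 ≤ √(∑ i, v i ^ 2) ^ 2 := by gcongr
    _ = _ := Real.sq_sqrt (Finset.sum_nonneg fun i _ => sq_nonneg _)

theorem exists_integral_norm_sq_charFun_le (hf : Continuous f) (hΦ : Continuous Φ)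
    (hα : 0 < α) (hc : 0 < c) (hp : 0 < p) (hαp : 2 * α * p < 1)
    (hlow : ∀ x ∈ Icc (0 : ℝ) 1, ∀ y ∈ Icc (0 : ℝ) 1, c * |x - y| ^ α ≤ ‖Φ x - Φ y‖) :
    ∃ K : ℝ, ∀ ξ : ℝ,
      ∫ t, ‖∫ x in Icc (0 : ℝ) 1,
        Complex.exp ((ξ * (f x + ∑ i, t i * Φ x i) : ℝ) * Complex.I)‖ ^ 2
        ∂(expNegSumSqMeasure d) ≤ K * (1 + ξ ^ 2) ^ (-p) := by
  set m : Measure ℝ := volume.restrict (Icc (0 : ℝ) 1) with hm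
  set A : ℝ := √Real.pi ^ d * (Real.exp (c ^ 2 / 4) * p ^ p * (c ^ 2 / 4) ^ (-p)) with hA
  refine ⟨A * ∫ z : ℝ × ℝ, |z.1 - z.2| ^ (-(2 * α * p)) ∂(m.prod m), fun ξ => ?_⟩
  refine (integral_norm_sq_integral_le (expNegSumSqMeasure d) m
    (e := fun t x => Complex.exp ((ξ * (f x + ∑ i, t i * Φ x i) : ℝ) * Complex.I))
    (Continuous.stronglyMeasurable (by fun_prop))
    (fun t x => (Complex.norm_exp_ofReal_mul_I _).le)).trans ?_
  simp_rw [norm_integral_phase_mul_conj]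
  rw [mul_right_comm, ← integral_const_mul]
  have hIcc : ∀ᵐ z : ℝ × ℝ ∂(m.prod m), z ∈ Icc (0 : ℝ) 1 ×ˢ Icc (0 : ℝ) 1 := by
    rw [hm, Measure.prod_restrict]
    exact ae_restrict_mem (measurableSet_Icc.prod measurableSet_Icc)
  refine integral_mono_of_nonneg (Filter.Eventually.of_forall fun z => by positivity)
    ((integrable_abs_sub_rpow hαp).const_mul _) ?_
  filter_upwards [hIcc, ae_fst_ne_snd m] with z hz hne
  obtain ⟨hx, hy⟩ := hz
  have hr0 : 0 < |z.1 - z.2| := abs_pos.2 (sub_ne_zero.2 hne)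
  have hr1 : |z.1 - z.2| ≤ 1 := abs_le.2 ⟨by linarith [hx.1, hy.2], by linarith [hx.2, hy.1]⟩
  set r := |z.1 - z.2| with hr
  have hrα : r ^ α ≤ 1 := Real.rpow_le_one hr0.le hr1 hα.le
  have hrα0 : 0 < r ^ α := Real.rpow_pos_of_pos hr0 _
  have hu : 0 < (c * r ^ α) ^ 2 / 4 := by positivity
  have huU : (c * r ^ α) ^ 2 / 4 ≤ c ^ 2 / 4 := by
    have : c * r ^ α ≤ c := by nlinarith
    gcongr
  have hmono : (c * r ^ α) ^ 2 / 4 ≤ (∑ i, (Φ z.1 i - Φ z.2 i) ^ 2) / 4 := by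
    have := sq_norm_le_sum_sq (Φ z.1 - Φ z.2)
    simp only [Pi.sub_apply] at this
    have h2 : (c * r ^ α) ^ 2 ≤ ‖Φ z.1 - Φ z.2‖ ^ 2 := by
      gcongr
      exact hlow _ hx _ hy
    linarith
  have hpow : ((c * r ^ α) ^ 2 / 4) ^ (-p) = (c ^ 2 / 4) ^ (-p) * r ^ (-(2 * α * p)) := by
    have hsq : (r ^ α) ^ 2 = r ^ (2 * α) := by
      rw [← Real.rpow_natCast (r ^ α) 2, ← Real.rpow_mul hr0.le]
      congr 1
      push_cast
      ring
    rw [mul_pow, mul_div_right_comm, Real.mul_rpow (by positivity) (by positivity), hsq,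
      ← Real.rpow_mul hr0.le]
    congr 2
    ring
  calc √Real.pi ^ d * Real.exp (-(ξ ^ 2 * ((∑ i, (Φ z.1 i - Φ z.2 i) ^ 2) / 4)))
      ≤ √Real.pi ^ d * Real.exp (-(ξ ^ 2 * ((c * r ^ α) ^ 2 / 4))) := by gcongr
    _ ≤ √Real.pi ^ d * (Real.exp (c ^ 2 / 4) * p ^ p * (1 + ξ ^ 2) ^ (-p) *
          ((c * r ^ α) ^ 2 / 4) ^ (-p)) := by
        gcongr
        exact exp_neg_sq_mul_le hu huU hp
    _ = A * (1 + ξ ^ 2) ^ (-p) * r ^ (-(2 * α * p)) := by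
        rw [hpow, hA]; ring

theorem ae_integrable_integral_phase (hf : Continuous f) (hΦ : Continuous Φ)
    (hα : 0 < α) (hα2 : α < 1 / 2) (hc : 0 < c)
    (hlow : ∀ x ∈ Icc (0 : ℝ) 1, ∀ y ∈ Icc (0 : ℝ) 1, c * |x - y| ^ α ≤ ‖Φ x - Φ y‖) :
    ∀ᵐ t : Fin d → ℝ, Integrable fun ξ : ℝ => ∫ x in Icc (0 : ℝ) 1,
      Complex.exp ((ξ * (f x + ∑ i, t i * Φ x i) : ℝ) * Complex.I) := by
  obtain ⟨p, hp, hpα⟩ : ∃ p : ℝ, 1 < p ∧ p < 1 / (2 * α) :=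
    exists_between (by rw [lt_div_iff₀ (by positivity)]; linarith)
  have hαp : 2 * α * p < 1 := by
    rw [lt_div_iff₀ (by positivity)] at hpα; linarith
  obtain ⟨K, hK⟩ := exists_integral_norm_sq_charFun_le hf hΦ hα hc (by linarith) hαp hlow
  let F : ℝ × (Fin d → ℝ) → ℂ := fun q => ∫ x in Icc (0 : ℝ) 1,
      Complex.exp ((q.1 * (f x + ∑ i, q.2 i * Φ x i) : ℝ) * Complex.I)
  have hFm : StronglyMeasurable F :=
    StronglyMeasurable.integral_prod_right (Continuous.stronglyMeasurable (by fun_prop))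
  have hF1 : ∀ q, ‖F q‖ ≤ 1 := fun q => by
    refine (norm_integral_le_integral_norm _).trans ?_
    simp_rw [Complex.norm_exp_ofReal_mul_I]
    simp
  replace hK : ∀ ξ, ∫ t, ‖F (ξ, t)‖ ^ 2 ∂(expNegSumSqMeasure d) ≤ K * (1 + ξ ^ 2) ^ (-p) := hK
  suffices h : ∀ᵐ t : Fin d → ℝ, Integrable fun ξ : ℝ => F (ξ, t) from h
  clear_value F
  have hJ : Integrable fun ξ : ℝ => (1 + ξ ^ 2) ^ (-p / 2) := by
    simpa using integrable_rpow_neg_one_add_norm_sq (E := ℝ) (μ := volume) (r := p)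
      (by simpa using hp)
  have hw : Measurable fun ξ : ℝ => (1 + ξ ^ 2) ^ (p / 2) := by fun_prop
  have hint : Integrable (fun q : ℝ × (Fin d → ℝ) => (1 + q.1 ^ 2) ^ (p / 2) * ‖F q‖ ^ 2)
      (volume.prod (expNegSumSqMeasure d)) := by
    have hmeas : AEStronglyMeasurable
        (fun q : ℝ × (Fin d → ℝ) => (1 + q.1 ^ 2) ^ (p / 2) * ‖F q‖ ^ 2)
        (volume.prod (expNegSumSqMeasure d)) :=
      ((hw.comp measurable_fst).mul (hFm.norm.measurable.pow_const 2)).aestronglyMeasurable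
    refine (integrable_prod_iff hmeas).2 ⟨Filter.Eventually.of_forall fun ξ => ?_, ?_⟩
    · have hb : Integrable (fun t => ‖F (ξ, t)‖ ^ 2) (expNegSumSqMeasure d) := by
        have hs : StronglyMeasurable fun t => F (ξ, t) :=
          hFm.comp_measurable measurable_prodMk_left
        refine Integrable.of_bound (hs.norm.pow 2).aestronglyMeasurable 1
          (Filter.Eventually.of_forall fun t => ?_)
        rw [norm_pow, norm_norm]
        exact pow_le_one₀ (norm_nonneg _) (hF1 _)
      exact hb.const_mul ((1 + ξ ^ 2) ^ (p / 2))
    · refine (hJ.const_mul K).mono' hmeas.norm.integral_prod_right'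
        (Filter.Eventually.of_forall fun ξ => ?_)
      rw [Real.norm_of_nonneg (integral_nonneg fun t => norm_nonneg _)]
      have hξ : 0 < 1 + ξ ^ 2 := by positivity
      simp only [norm_mul, norm_pow, norm_norm]
      rw [integral_const_mul, Real.norm_of_nonneg (by positivity)]
      calc (1 + ξ ^ 2) ^ (p / 2) * ∫ t, ‖F (ξ, t)‖ ^ 2 ∂(expNegSumSqMeasure d)
          ≤ (1 + ξ ^ 2) ^ (p / 2) * (K * (1 + ξ ^ 2) ^ (-p)) := by
            gcongr
            exact hK ξ
        _ = K * (1 + ξ ^ 2) ^ (-p / 2) := by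
            rw [mul_left_comm, ← Real.rpow_add hξ]
            congr 2
            ring
  refine (volume_absolutelyContinuous_expNegSumSqMeasure d).ae_le ?_
  filter_upwards [hint.prod_left_ae] with t ht
  refine (ht.add hJ).mono' (hFm.comp_measurable measurable_prodMk_right).aestronglyMeasurable
    (Filter.Eventually.of_forall fun ξ => ?_)
  change ‖F (ξ, t)‖ ≤ (1 + ξ ^ 2) ^ (p / 2) * ‖F (ξ, t)‖ ^ 2 + (1 + ξ ^ 2) ^ (-p / 2)
  rw [neg_div, Real.rpow_neg (by positivity)]
  have hw0 : 0 < (1 + ξ ^ 2) ^ (p / 2) := by positivity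
  set w := (1 + ξ ^ 2) ^ (p / 2)
  set a := ‖F (ξ, t)‖
  have hwi : w * w⁻¹ = 1 := mul_inv_cancel₀ hw0.ne'
  have : a ≤ w⁻¹ * ((w * a) ^ 2 + 1) := by
    rw [inv_mul_eq_div, le_div_iff₀ hw0]
    nlinarith [sq_nonneg (w * a - 1), norm_nonneg (F (ξ, t))]
  calc a ≤ w⁻¹ * ((w * a) ^ 2 + 1) := this
    _ = (w * w⁻¹) * w * a ^ 2 + w⁻¹ := by ring
    _ = _ := by rw [hwi, one_mul]

end OccupationMeasure

theorem continuousOn_of_norm_sub_le_rpow {E : Type*} [SeminormedAddCommGroup E] {g : ℝ → E}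
    {s : Set ℝ} {α C : ℝ} (hα : 0 < α)
    (hg : ∀ x ∈ s, ∀ y ∈ s, ‖g x - g y‖ ≤ C * |x - y| ^ α) : ContinuousOn g s := by
  intro x hx
  have h0 : Filter.Tendsto (fun y => C * |y - x| ^ α) (nhdsWithin x s) (nhds 0) := by
    have : ContinuousAt (fun y : ℝ => C * |y - x| ^ α) x := by
      refine continuousAt_const.mul (ContinuousAt.rpow_const (by fun_prop) (Or.inr hα.le))
    have h := this.tendsto
    simp only [sub_self, abs_zero, Real.zero_rpow hα.ne', mul_zero] at h
    exact h.mono_left nhdsWithin_le_nhds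
  refine tendsto_iff_norm_sub_tendsto_zero.2
    (squeeze_zero' (Filter.Eventually.of_forall fun y => norm_nonneg _) ?_ h0)
  filter_upwards [self_mem_nhdsWithin] with y hy using hg y hy x hx

theorem stmt_15 (α C : ℝ) (hα : 0 < α) (hα2 : α < 1/2) (hC : 0 < C)
    (f : ℝ → ℝ) (hf : ∀ x ∈ Icc (0:ℝ) 1, ∀ z ∈ Icc (0:ℝ) 1, |f x - f z| ≤ C * |x - z| ^ α)
    (d : ℕ) (Φ : ℝ → (Fin d → ℝ)) (c₁ c₂ : ℝ) (hc₁ : 0 < c₁) (hc₂ : 0 < c₂)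
    (hΦ : ∀ x ∈ Icc (0:ℝ) 1, ∀ y ∈ Icc (0:ℝ) 1,
      c₁ * |x - y| ^ α ≤ ‖Φ x - Φ y‖ ∧ ‖Φ x - Φ y‖ ≤ c₂ * |x - y| ^ α) :
    ∀ᵐ t : Fin d → ℝ ∂volume,
      ∃ h : ℝ → ℝ, Continuous h ∧ (∃ M : ℝ, ∀ y, h y ≤ M) ∧ (∀ y, 0 ≤ h y) ∧
        ∀ A : Set ℝ, MeasurableSet A →
          Measure.map (fun x => f x + ∑ i, t i * Φ x i) (volume.restrict (Icc (0:ℝ) 1)) A =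
            ENNReal.ofReal (∫ y in A, h y) := by
  have hfc : ContinuousOn f (Icc 0 1) := continuousOn_of_norm_sub_le_rpow hα hf
  have hΦc : ContinuousOn Φ (Icc 0 1) :=
    continuousOn_of_norm_sub_le_rpow hα fun x hx y hy => (hΦ x hx y hy).2
  set g : ℝ → ℝ := IccExtend zero_le_one ((Icc (0 : ℝ) 1).domRestrict f) with hg
  set Ψ : ℝ → Fin d → ℝ := IccExtend zero_le_one ((Icc (0 : ℝ) 1).domRestrict Φ) with hΨ
  have hgc : Continuous g := hfc.domRestrict.Icc_extend'
  have hΨc : Continuous Ψ := hΦc.domRestrict.Icc_extend'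
  have hgf : ∀ x ∈ Icc (0 : ℝ) 1, g x = f x := fun x hx => by
    rw [hg, IccExtend_of_mem _ _ hx, domRestrict_apply]
  have hΨΦ : ∀ x ∈ Icc (0 : ℝ) 1, Ψ x = Φ x := fun x hx => by
    rw [hΨ, IccExtend_of_mem _ _ hx, domRestrict_apply]
  filter_upwards [ae_integrable_integral_phase hgc hΨc hα hα2 hc₁ fun x hx y hy => by
    rw [hΨΦ x hx, hΨΦ y hy]; exact (hΦ x hx y hy).1] with t ht
  have hmap : Measure.map (fun x => f x + ∑ i, t i * Φ x i) (volume.restrict (Icc (0:ℝ) 1)) =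
      Measure.map (fun x => g x + ∑ i, t i * Ψ x i) (volume.restrict (Icc (0:ℝ) 1)) := by
    refine Measure.map_congr ?_
    filter_upwards [ae_restrict_mem measurableSet_Icc] with x hx
    rw [hgf x hx, hΨΦ x hx]
  rw [hmap]
  refine exists_continuous_density_of_integrable_charFun (ht.congr ?_)
  refine Filter.Eventually.of_forall fun ξ => ?_
  rw [charFun_apply_real, integral_map (Continuous.aemeasurable (by fun_prop))
    (Continuous.aestronglyMeasurable (by fun_prop))]
  simp only [Complex.ofReal_mul]
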